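/- For every integer n ≥ 0, the number of lattice paths of length 2n+1 that stay in the strip [-2, 1] and end at height -1 equals the Fibonacci number F(2n+2). -/

import Mathlib

/-- The height of a lattice path `s : Fin n → ℤ` after `j` steps:
the sum of the first `j` steps. -/
def pathHeight {n : ℕ} (s : Fin n → ℤ) (j : ℕ) : ℤ :=
  ∑ i ∈ Finset.univ.filter (fun i : Fin n => (i : ℕ) < j), s i

/-- The number of lattice paths of length `n` (steps `±1`) whose height stays in
`[a, b]` at every time `0 ≤ j ≤ n` and whose final height lies in `E`. -/
noncomputable def pathCount (n : ℕ) (a b : ℤ) (E : Set ℤ) : ℕ :=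
  Nat.card {s : Fin n → ℤ //
    (∀ i, s i ∈ ({1, -1} : Set ℤ)) ∧
    (∀ j ≤ n, pathHeight s j ∈ Set.Icc a b) ∧
    pathHeight s n ∈ E}

/-- The lattice paths of length `n` that stay in `[a, b]` and end in `E`. -/
def pathSet (n : ℕ) (a b : ℤ) (E : Set ℤ) : Set (Fin n → ℤ) :=
  {s | (∀ i, s i ∈ ({1, -1} : Set ℤ)) ∧
    (∀ j ≤ n, pathHeight s j ∈ Set.Icc a b) ∧ pathHeight s n ∈ E}

theorem pathCount_eq_ncard (n : ℕ) (a b : ℤ) (E : Set ℤ) :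
    pathCount n a b E = (pathSet n a b E).ncard := rfl

theorem pathSet_finite (n : ℕ) (a b : ℤ) (E : Set ℤ) : (pathSet n a b E).Finite :=
  (Set.Finite.pi' fun _ : Fin n => Set.toFinite ({1, -1} : Set ℤ)).subset fun _ hs => hs.1

theorem pathHeight_snoc_of_le {n : ℕ} (s : Fin n → ℤ) (x : ℤ) {j : ℕ} (hj : j ≤ n) :
    pathHeight (Fin.snoc s x : Fin (n + 1) → ℤ) j = pathHeight s j := by
  simp [pathHeight, Finset.sum_filter, Fin.sum_univ_castSucc, hj]

theorem pathHeight_snoc_succ {n : ℕ} (s : Fin n → ℤ) (x : ℤ) :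
    pathHeight (Fin.snoc s x : Fin (n + 1) → ℤ) (n + 1) = pathHeight s n + x := by
  simp [pathHeight, Finset.sum_filter, Fin.sum_univ_castSucc]

theorem snoc_mem_pathSet_iff {n : ℕ} {a b m : ℤ} (hm : m ∈ Set.Icc a b)
    (s : Fin n → ℤ) (x : ℤ) :
    (Fin.snoc s x : Fin (n + 1) → ℤ) ∈ pathSet (n + 1) a b {m} ↔
      (x = 1 ∨ x = -1) ∧ s ∈ pathSet n a b {m - x} := by
  have hle : (∀ j ≤ n + 1, pathHeight (Fin.snoc s x : Fin (n + 1) → ℤ) j ∈ Set.Icc a b) ↔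
      (∀ j ≤ n, pathHeight s j ∈ Set.Icc a b) ∧ pathHeight s n + x ∈ Set.Icc a b := by
    constructor
    · intro h
      refine ⟨fun j hj => ?_, ?_⟩
      · rw [← pathHeight_snoc_of_le s x hj]
        exact h j (by omega)
      · rw [← pathHeight_snoc_succ]
        exact h _ le_rfl
    · rintro ⟨h, h'⟩ j hj
      rcases Nat.le_succ_iff.mp hj with hj | rfl
      · rw [pathHeight_snoc_of_le s x hj]
        exact h j hj
      · rwa [pathHeight_snoc_succ]
  have hend : pathHeight s n = m - x ↔ pathHeight s n + x = m := by omega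
  simp only [pathSet, Set.mem_ofPred_eq, hle, pathHeight_snoc_succ, Fin.forall_fin_succ',
    Fin.snoc_castSucc, Fin.snoc_last, Set.mem_singleton_iff, Set.mem_insert_iff, hend]
  constructor
  · rintro ⟨⟨h1, h2⟩, ⟨h3, -⟩, h4⟩
    exact ⟨h2, h1, h3, h4⟩
  · rintro ⟨h2, h1, h3, h4⟩
    exact ⟨⟨h1, h2⟩, ⟨h3, h4 ▸ hm⟩, h4⟩

theorem pathCount_succ (n : ℕ) {a b m : ℤ} (hm : m ∈ Set.Icc a b) :
    pathCount (n + 1) a b {m} = pathCount n a b {m - 1} + pathCount n a b {m + 1} := by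
  let f (x : ℤ) (s : Fin n → ℤ) : Fin (n + 1) → ℤ := Fin.snoc s x
  have hf (x : ℤ) : Function.Injective (f x) := fun s t h => (Fin.snoc_inj.mp h).1
  have hunion : pathSet (n + 1) a b {m} =
      f 1 '' pathSet n a b {m - 1} ∪ f (-1) '' pathSet n a b {m + 1} := by
    ext s
    constructor
    · intro hs
      rw [← Fin.snoc_init_self s, snoc_mem_pathSet_iff hm] at hs
      obtain ⟨hx | hx, hs⟩ := hs
      · rw [hx] at hs
        exact Or.inl ⟨Fin.init s, hs, by simp only [f, ← hx, Fin.snoc_init_self]⟩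
      · rw [hx, sub_neg_eq_add] at hs
        exact Or.inr ⟨Fin.init s, hs, by simp only [f, ← hx, Fin.snoc_init_self]⟩
    · rintro (⟨t, ht, rfl⟩ | ⟨t, ht, rfl⟩)
      · exact (snoc_mem_pathSet_iff hm t 1).mpr ⟨Or.inl rfl, ht⟩
      · exact (snoc_mem_pathSet_iff hm t (-1)).mpr ⟨Or.inr rfl, by rwa [sub_neg_eq_add]⟩
  have hdisj : Disjoint (f 1 '' pathSet n a b {m - 1}) (f (-1) '' pathSet n a b {m + 1}) := by
    rw [Set.disjoint_left]
    rintro _ ⟨s, -, rfl⟩ ⟨t, -, h⟩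
    have := (Fin.snoc_inj.mp h).2
    omega
  simp only [pathCount_eq_ncard]
  rw [hunion, Set.ncard_union_eq hdisj ((pathSet_finite _ _ _ _).image _)
    ((pathSet_finite _ _ _ _).image _), Set.ncard_image_of_injective _ (hf _),
    Set.ncard_image_of_injective _ (hf _)]

theorem pathCount_eq_zero_of_notMem (n : ℕ) {a b m : ℤ} (hm : m ∉ Set.Icc a b) :
    pathCount n a b {m} = 0 := by
  rw [pathCount_eq_ncard, Set.ncard_eq_zero (pathSet_finite _ _ _ _),
    Set.eq_empty_iff_forall_notMem]
  rintro s ⟨-, h, h'⟩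
  exact hm (h' ▸ h n le_rfl)

theorem pathCount_zero {a b m : ℤ} (h0 : (0 : ℤ) ∈ Set.Icc a b) :
    pathCount 0 a b {m} = if m = 0 then 1 else 0 := by
  have h (s : Fin 0 → ℤ) (j : ℕ) : pathHeight s j = 0 := by simp [pathHeight]
  rw [pathCount_eq_ncard]
  split_ifs with hm
  · have : pathSet 0 a b {m} = Set.univ := by
      ext s
      simp only [pathSet, h, hm, h0]
      simp
    simp [this]
  · have : pathSet 0 a b {m} = ∅ := by
      ext s
      simp [pathSet, h, Ne.symm hm]
    simp [this]

theorem pathCount_odd_eq_fib (n : ℕ) :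
    pathCount (2 * n + 1) (-2) 1 {-1} = Nat.fib (2 * n + 2) ∧
      pathCount (2 * n + 1) (-2) 1 {1} = Nat.fib (2 * n + 1) := by
  have hout (k : ℕ) : pathCount k (-2) 1 {-3} = 0 ∧ pathCount k (-2) 1 {2} = 0 :=
    ⟨pathCount_eq_zero_of_notMem k (by simp), pathCount_eq_zero_of_notMem k (by simp)⟩
  have hneg (k : ℕ) : pathCount (k + 1) (-2) 1 {-1} =
      pathCount k (-2) 1 {-2} + pathCount k (-2) 1 {0} := pathCount_succ k (by simp)
  have hone (k : ℕ) : pathCount (k + 1) (-2) 1 {1} =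
      pathCount k (-2) 1 {0} + pathCount k (-2) 1 {2} := pathCount_succ k (by simp)
  have hzero (k : ℕ) : pathCount (k + 1) (-2) 1 {0} =
      pathCount k (-2) 1 {-1} + pathCount k (-2) 1 {1} := pathCount_succ k (by simp)
  have hbot (k : ℕ) : pathCount (k + 1) (-2) 1 {-2} =
      pathCount k (-2) 1 {-3} + pathCount k (-2) 1 {-1} := pathCount_succ k (by simp)
  induction n with
  | zero =>
    rw [hneg, hone]
    simp [pathCount_zero]
  | succ n ih =>
    have h3 : Nat.fib (2 * n + 3) = Nat.fib (2 * n + 1) + Nat.fib (2 * n + 2) := Nat.fib_add_two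
    have h4 : Nat.fib (2 * n + 4) = Nat.fib (2 * n + 2) + Nat.fib (2 * n + 3) := Nat.fib_add_two
    rw [show 2 * (n + 1) + 1 = 2 * n + 1 + 1 + 1 by ring, hneg, hone, hzero, hbot, (hout _).1,
      (hout _).2, ih.1, ih.2]
    simp only [show 2 * (n + 1) + 2 = 2 * n + 4 by ring, show 2 * n + 1 + 1 + 1 = 2 * n + 3 by ring]
    omega

theorem stmt_17 (n : ℕ) :
    pathCount (2 * n + 1) (-2) 1 ({-1} : Set ℤ) = Nat.fib (2 * n + 2) :=
  (pathCount_odd_eq_fib n).1
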